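/- Let A be a finite-dimensional weak Hopf algebra over a field k and let M be a left A-module algebra. Then for any two-sided ideal I of M, the subspace A·I = span{h·x : h ∈ A, x ∈ I} is a two-sided ideal of M which is stable under the action of A (i.e., A·(A·I) ⊆ A·I). -/

import Mathlib

open TensorProduct

noncomputable section

variable (k : Type*) [Field k] (A : Type*) [Ring A] [Algebra k A]

/-- A weak Hopf algebra structure on the `k`-algebra `A` (Böhm–Szlachányi). -/
structure WeakHopf : Type _ where
  comul : A →ₗ[k] A ⊗[k] A
  counit : A →ₗ[k] k
  antipode : A →ₗ[k] A
  antipode_bijective : Function.Bijective antipode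
  comul_coassoc :
      (TensorProduct.map comul LinearMap.id).comp comul
        = (TensorProduct.assoc k A A A).symm.toLinearMap.comp
            ((TensorProduct.map LinearMap.id comul).comp comul)
  counit_comul_left : ∀ a : A,
      TensorProduct.lid k A (TensorProduct.map counit LinearMap.id (comul a)) = a
  counit_comul_right : ∀ a : A,
      TensorProduct.rid k A (TensorProduct.map LinearMap.id counit (comul a)) = a
  comul_mul : ∀ g h : A, comul (g * h) = comul g * comul h
  comul_one_left :
      TensorProduct.map comul LinearMap.id (comul 1)
        = (comul 1 ⊗ₜ[k] (1 : A))
            * (TensorProduct.assoc k A A A).symm ((1 : A) ⊗ₜ[k] comul 1)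
  comul_one_right :
      TensorProduct.map comul LinearMap.id (comul 1)
        = (TensorProduct.assoc k A A A).symm ((1 : A) ⊗ₜ[k] comul 1)
            * (comul 1 ⊗ₜ[k] (1 : A))
  counit_mul_left : ∀ f g h : A,
      counit (f * g * h)
        = TensorProduct.lift ((LinearMap.mul k k).compl₁₂
            (counit ∘ₗ LinearMap.mulLeft k f) (counit ∘ₗ LinearMap.mulRight k h)) (comul g)
  counit_mul_right : ∀ f g h : A,
      counit (f * g * h)
        = TensorProduct.lift ((LinearMap.mul k k).compl₁₂
            (counit ∘ₗ LinearMap.mulRight k h) (counit ∘ₗ LinearMap.mulLeft k f)) (comul g)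
  antipode_left : ∀ h : A,
      LinearMap.mul' k A (TensorProduct.map LinearMap.id antipode (comul h))
        = TensorProduct.lid k A
            (TensorProduct.map counit LinearMap.id (comul 1 * (h ⊗ₜ[k] (1 : A))))
  antipode_right : ∀ h : A,
      LinearMap.mul' k A (TensorProduct.map antipode LinearMap.id (comul h))
        = TensorProduct.rid k A
            (TensorProduct.map LinearMap.id counit (((1 : A) ⊗ₜ[k] h) * comul 1))
  antipode_mid : ∀ h : A,
      LinearMap.mul' k A (TensorProduct.map (LinearMap.mul' k A) LinearMap.id
        (TensorProduct.map (TensorProduct.map antipode LinearMap.id) antipode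
          (TensorProduct.map comul LinearMap.id (comul h))))
        = antipode h

namespace WeakHopf

variable {k A}
variable (W : WeakHopf k A)

/-- The target counital map `ε_t(h) = ε(1₍₁₎h)1₍₂₎ = (ε ⊗ id)(Δ(1)(h ⊗ 1))`. -/
def εt : A →ₗ[k] A :=
  (TensorProduct.lid k A).toLinearMap
    ∘ₗ TensorProduct.map W.counit LinearMap.id
    ∘ₗ LinearMap.mulLeft k (W.comul 1)
    ∘ₗ (TensorProduct.mk k A A).flip 1

/-- The source counital map `ε_s(h) = 1₍₁₎ε(h1₍₂₎) = (id ⊗ ε)((1 ⊗ h)Δ(1))`. -/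
def εs : A →ₗ[k] A :=
  (TensorProduct.rid k A).toLinearMap
    ∘ₗ TensorProduct.map LinearMap.id W.counit
    ∘ₗ LinearMap.mulRight k (W.comul 1)
    ∘ₗ TensorProduct.mk k A A 1

/-- The target base `A_t = ε_t(A)`. -/
def targetBase : Submodule k A := LinearMap.range W.εt

/-- The source base `A_s = ε_s(A)`. -/
def sourceBase : Submodule k A := LinearMap.range W.εs

/-- The minimal weak Hopf subalgebra, generated by `A_s` and `A_t`. -/
def minimalSub : Subalgebra k A :=
  Algebra.adjoin k ((W.targetBase : Set A) ∪ (W.sourceBase : Set A))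

/-- `A` is regular if `S²` is the identity on `A_min`. -/
def Regular : Prop := ∀ x ∈ W.minimalSub, W.antipode (W.antipode x) = x

/-- `A` is connected if `Z(A) ∩ A_t = k·1`. -/
def Connected : Prop :=
  ∀ a : A, (a ∈ Subalgebra.center k A ∧ a ∈ W.targetBase) ↔ ∃ c : k, a = c • (1 : A)

/-- `A` is coconnected if `A_s ∩ A_t = k·1`. -/
def Coconnected : Prop :=
  ∀ a : A, (a ∈ W.sourceBase ∧ a ∈ W.targetBase) ↔ ∃ c : k, a = c • (1 : A)

def Biconnected : Prop := W.Connected ∧ W.Coconnected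

/-- A left integral: `hℓ = ε_t(h)ℓ` for all `h`. -/
def IsLeftIntegral (ℓ : A) : Prop := ∀ h : A, h * ℓ = W.εt h * ℓ

/-- A right integral: `rh = rε_s(h)` for all `h`. -/
def IsRightIntegral (r : A) : Prop := ∀ h : A, r * h = r * W.εs h

/-- The Sweedler arrow `φ ⇀ a = a₍₁₎⟨φ, a₍₂₎⟩`. -/
def harpoon (φ : Module.Dual k A) : A →ₗ[k] A :=
  (TensorProduct.rid k A).toLinearMap
    ∘ₗ TensorProduct.map LinearMap.id φ
    ∘ₗ W.comul

/-- An integral `ℓ` is non-degenerate if `φ ↦ φ ⇀ ℓ` is injective. -/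
def IsNondegenerateIntegral (ℓ : A) : Prop :=
  Function.Injective fun φ : Module.Dual k A => W.harpoon φ ℓ

/-- The convolution product on the dual: `(φψ)(h) = φ(h₍₁₎)ψ(h₍₂₎)`. -/
def conv (φ ψ : Module.Dual k A) : Module.Dual k A :=
  TensorProduct.lift ((LinearMap.mul k k).compl₁₂ φ ψ) ∘ₗ W.comul

/-- The canonical left integral `λ ∈ A*`, `λ(h) = Tr(L_h ∘ S²)`. -/
def canonicalLambda : Module.Dual k A :=
  (LinearMap.trace k A)
    ∘ₗ (LinearMap.llcomp k A A A).flip (W.antipode ∘ₗ W.antipode)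
    ∘ₗ (LinearMap.mul k A)

/-- The target counital map of the dual weak Hopf algebra: `ε̂_t(φ) = φ ∘ ε_t`. -/
def dualCounitalTarget (φ : Module.Dual k A) : Module.Dual k A := φ ∘ₗ W.εt

/-- The source counital map of the dual weak Hopf algebra: `ε̂_s(φ) = φ ∘ ε_s`. -/
def dualCounitalSource (φ : Module.Dual k A) : Module.Dual k A := φ ∘ₗ W.εs

/-- The map `a ↦ e(a₍₁₎)a₍₂₎`; left convolution by `e` on `A*` is precomposition
with this map. -/
def coactL (e : Module.Dual k A) : A →ₗ[k] A :=
  (TensorProduct.lid k A).toLinearMap ∘ₗ TensorProduct.map e LinearMap.id ∘ₗ W.comul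

/-- A group-like element: invertible with `Δ(g) = (g⊗g)Δ(1) = Δ(1)(g⊗g)`. -/
def IsGroupLike (g : A) : Prop :=
  IsUnit g ∧ W.comul g = (g ⊗ₜ[k] g) * W.comul 1 ∧ W.comul g = W.comul 1 * (g ⊗ₜ[k] g)

/-- A pivotal element: a group-like `G` with `S²(h) = GhG⁻¹`, i.e. `S²(h)G = Gh`. -/
def IsPivotal (g : A) : Prop :=
  W.IsGroupLike g ∧ ∀ h : A, W.antipode (W.antipode h) * g = g * h

/-- A trivial group-like element: `g = yS(y)⁻¹` for invertible `y ∈ A_s`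
(note `S(y)⁻¹ = S(y⁻¹)`). -/
def IsTrivialGroupLike (g : A) : Prop :=
  ∃ y yi : A, y ∈ W.sourceBase ∧ y * yi = 1 ∧ yi * y = 1 ∧ g = y * W.antipode yi

/-- The character of the trivial `A`-module `A_t`, `h · z = ε_t(hz)`. -/
def trivialChar : A → k := fun h =>
  LinearMap.trace k W.targetBase
    ((W.εt ∘ₗ LinearMap.mulLeft k h).restrict
      (p := W.targetBase) (q := W.targetBase) (fun x _ => ⟨h * x, rfl⟩))

end WeakHopf

/-- The Wedderburn data of a finite-dimensional semisimple algebra: a complete family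
of primitive central idempotents `z j`, together with the matrix sizes `d j`
(so that `(d j)² = dim_k (z j · A)`, i.e. the block `z j · A ≅ M_{d j}(k)`). -/
structure WedderburnData (n : ℕ) : Type _ where
  z : Fin n → A
  d : Fin n → ℕ
  central : ∀ j, z j ∈ Subalgebra.center k A
  idem : ∀ j, z j * z j = z j
  nonzero : ∀ j, z j ≠ 0
  primitive : ∀ (j : Fin n) (q r : A), q ∈ Subalgebra.center k A →
      r ∈ Subalgebra.center k A → q * q = q → r * r = r → q * r = 0 →
      q + r = z j → q = 0 ∨ r = 0
  orthogonal : ∀ i j, i ≠ j → z i * z j = 0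
  total : ∑ j, z j = 1
  d_sq : ∀ j, (d j) ^ 2 = Module.finrank k (LinearMap.range (LinearMap.mulLeft k (z j)))

/-- The irreducible characters of a finite-dimensional semisimple algebra: the character
of the simple module corresponding to the block `z j · A` is
`χ_j(h) = Tr(L_{z_j h} | A) / d j`. -/
def WedderburnData.char {k A : Type*} [Field k] [Ring A] [Algebra k A] {n : ℕ}
    (D : WedderburnData k A n) : Fin n → Module.Dual k A := fun j =>
  (D.d j : k)⁻¹ •
    ((LinearMap.trace k A) ∘ₗ (LinearMap.mul k A) ∘ₗ LinearMap.mulLeft k (D.z j))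

/-- Frobenius–Perron data for a semisimple weak Hopf algebra over `ℂ`: the non-negative
integer structure constants of the products of the irreducible characters under
convolution, and the Frobenius–Perron dimensions `f j = FPdim(V_j)` of the simple
modules, i.e. the unique strictly positive solution of `f i · f j = Σ_m N i j m · f m`. -/
structure FPData {A : Type*} [Ring A] [Algebra ℂ A] (W : WeakHopf ℂ A) {n : ℕ}
    (D : WedderburnData ℂ A n) : Type _ where
  N : Fin n → Fin n → Fin n → ℕ
  conv_char : ∀ i j, W.conv (D.char i) (D.char j) = ∑ m, (N i j m : ℂ) • D.char m
  f : Fin n → ℝ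
  f_pos : ∀ j, 0 < f j
  f_mul : ∀ i j, f i * f j = ∑ m, (N i j m : ℝ) * f m

/-- A Frobenius–Perron element of `A_s`: a non-zero `w ∈ Z(A_s)` with strictly positive
eigenvalues such that `χ_{V_j} ⇀ w = FPdim(V_j) • w` for all simple modules `V_j`
(hence for all finite-dimensional modules). -/
def WeakHopf.IsFPElement {A : Type*} [Ring A] [Algebra ℂ A] (W : WeakHopf ℂ A) {n : ℕ}
    (D : WedderburnData ℂ A n) (F : FPData W D) (w : A) : Prop :=
  w ≠ 0 ∧ w ∈ W.sourceBase ∧ (∀ y ∈ W.sourceBase, w * y = y * w) ∧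
  (∀ c ∈ spectrum ℂ w, ∃ r : ℝ, 0 < r ∧ c = (r : ℂ)) ∧
  ∀ j, W.harpoon (D.char j) w = ((F.f j : ℂ)) • w

/-- A duality pairing realizing the weak Hopf algebra `B` as the dual `A*` of the weak
Hopf algebra `A` (so that `B` carries the dual weak Hopf algebra structure:
`⟨φψ, h⟩ = ⟨φ, h₍₁₎⟩⟨ψ, h₍₂₎⟩`, `1_B = ε_A`, `⟨Δφ, g ⊗ h⟩ = ⟨φ, gh⟩`,
`ε_B(φ) = ⟨φ, 1⟩`, `⟨S_B(φ), h⟩ = ⟨φ, S_A(h)⟩`). -/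
structure DualPair {k A B : Type*} [Field k] [Ring A] [Algebra k A] [Ring B] [Algebra k B]
    (W : WeakHopf k A) (W' : WeakHopf k B) : Type _ where
  pair : B →ₗ[k] Module.Dual k A
  bij : Function.Bijective pair
  mul_compat : ∀ φ ψ : B, pair (φ * ψ) = W.conv (pair φ) (pair ψ)
  one_compat : pair 1 = W.counit
  comul_compat : ∀ (φ : B) (g h : A),
      TensorProduct.lift ((LinearMap.mul k k).compl₁₂ (pair.flip g) (pair.flip h))
          (W'.comul φ) = pair φ (g * h)
  counit_compat : ∀ φ : B, W'.counit φ = pair φ 1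
  antipode_compat : ∀ (φ : B) (h : A), pair (W'.antipode φ) h = pair φ (W.antipode h)

namespace WeakHopf

section Aux

variable {k A}
variable (W : WeakHopf k A)

/-- Contraction of the middle tensor factor with the counit. -/
def kap2 : (A ⊗[k] A) ⊗[k] A →ₗ[k] A ⊗[k] A :=
  TensorProduct.map ((TensorProduct.rid k A).toLinearMap ∘ₗ
    TensorProduct.map LinearMap.id W.counit) LinearMap.id

lemma kap2_tmul (a b c : A) : W.kap2 ((a ⊗ₜ b) ⊗ₜ c) = (W.counit b • a) ⊗ₜ[k] c := by
  simp [kap2]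

lemma εt_apply (h : A) : W.εt h = TensorProduct.lid k A
    (TensorProduct.map W.counit LinearMap.id (W.comul 1 * (h ⊗ₜ[k] (1 : A)))) := rfl

lemma εs_apply (h : A) : W.εs h = TensorProduct.rid k A
    (TensorProduct.map LinearMap.id W.counit (((1 : A) ⊗ₜ[k] h) * W.comul 1)) := rfl

lemma coassoc_apply' (h : A) : TensorProduct.map W.comul LinearMap.id (W.comul h)
    = (TensorProduct.assoc k A A A).symm (TensorProduct.map LinearMap.id W.comul (W.comul h)) :=
  LinearMap.congr_fun W.comul_coassoc h

lemma comul_one_mul (h : A) : W.comul 1 * W.comul h = W.comul h := by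
  rw [← W.comul_mul, one_mul]

lemma comul_mul_one (h : A) : W.comul h * W.comul 1 = W.comul h := by
  rw [← W.comul_mul, mul_one]

/-- `R(y) = 1 ⊗ y` -/
def rr : A ⊗[k] A →ₗ[k] (A ⊗[k] A) ⊗[k] A :=
  (TensorProduct.assoc k A A A).symm.toLinearMap ∘ₗ TensorProduct.mk k A (A ⊗[k] A) 1

lemma rr_apply (y : A ⊗[k] A) :
    (TensorProduct.assoc k A A A).symm ((1 : A) ⊗ₜ[k] y) = rr y := rfl

lemma rr_tmul (a b : A) : rr (k := k) (a ⊗ₜ b) = (1 ⊗ₜ a) ⊗ₜ b := rfl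

lemma kap2_rr_left (x D : A ⊗[k] A) :
    W.kap2 (rr D * (x ⊗ₜ 1)) = TensorProduct.map LinearMap.id
      ((TensorProduct.lid k A).toLinearMap ∘ₗ TensorProduct.map W.counit LinearMap.id
        ∘ₗ LinearMap.mulLeft k D ∘ₗ (TensorProduct.mk k A A).flip 1) x := by
  induction x with
  | zero => simp
  | add x y hx hy => simp only [TensorProduct.add_tmul, mul_add, map_add, hx, hy]
  | tmul a b =>
    induction D with
    | zero => simp
    | add x y hx hy =>
      simp only [TensorProduct.map_tmul, LinearMap.comp_apply, LinearMap.mulLeft_apply,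
        map_add, add_mul, TensorProduct.tmul_add] at hx hy ⊢
      rw [hx, hy]
    | tmul c d => simp [rr_tmul, kap2_tmul, TensorProduct.smul_tmul]

lemma kap2_rr_right (x D : A ⊗[k] A) :
    W.kap2 (rr x * (D ⊗ₜ 1)) = TensorProduct.map
      ((TensorProduct.rid k A).toLinearMap ∘ₗ TensorProduct.map LinearMap.id W.counit
        ∘ₗ LinearMap.mulRight k D ∘ₗ TensorProduct.mk k A A 1) LinearMap.id x := by
  induction x with
  | zero => simp
  | add x y hx hy => simp only [add_mul, map_add, hx, hy]
  | tmul a b =>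
    induction D with
    | zero => simp
    | add x y hx hy =>
      simp only [TensorProduct.map_tmul, LinearMap.comp_apply, LinearMap.mulRight_apply,
        map_add, mul_add, TensorProduct.add_tmul] at hx hy ⊢
      rw [hx, hy]
    | tmul c d => simp [rr_tmul, kap2_tmul]

lemma map_id_εt (x : A ⊗[k] A) : TensorProduct.map LinearMap.id W.εt x
    = W.kap2 (rr (W.comul 1) * (x ⊗ₜ 1)) := (W.kap2_rr_left x (W.comul 1)).symm

lemma map_εs_id (x : A ⊗[k] A) : TensorProduct.map W.εs LinearMap.id x
    = W.kap2 (rr x * (W.comul 1 ⊗ₜ 1)) := (W.kap2_rr_right x (W.comul 1)).symm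

lemma kap2_comul_left (x : A ⊗[k] A) :
    W.kap2 (TensorProduct.map W.comul LinearMap.id x) = x := by
  induction x with
  | zero => simp
  | add x y hx hy => simp only [map_add, hx, hy]
  | tmul a b =>
    simp only [TensorProduct.map_tmul, kap2, LinearMap.comp_apply, LinearMap.id_apply]
    congr 1
    exact W.counit_comul_right a

lemma kap2_comul_right (x : A ⊗[k] A) :
    W.kap2 ((TensorProduct.assoc k A A A).symm (TensorProduct.map LinearMap.id W.comul x)) = x := by
  have key : ∀ (a : A) (y : A ⊗[k] A), W.kap2 ((TensorProduct.assoc k A A A).symm (a ⊗ₜ y))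
      = a ⊗ₜ TensorProduct.lid k A (TensorProduct.map W.counit LinearMap.id y) := by
    intro a y
    induction y with
    | zero => simp
    | add x y hx hy => simp only [map_add, TensorProduct.tmul_add, hx, hy]
    | tmul b c => simp [kap2_tmul, TensorProduct.smul_tmul]
  induction x with
  | zero => simp
  | add x y hx hy => simp only [map_add, hx, hy]
  | tmul a b =>
    rw [TensorProduct.map_tmul, key, W.counit_comul_left]; rfl

lemma comul_left_mul (x : A ⊗[k] A) (h : A) :
    TensorProduct.map W.comul LinearMap.id x * (W.comul h ⊗ₜ 1)
      = TensorProduct.map W.comul LinearMap.id (x * (h ⊗ₜ 1)) := by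
  induction x with
  | zero => simp
  | add x y hx hy => simp only [map_add, add_mul, hx, hy]
  | tmul a b => simp [W.comul_mul]

lemma comul_right_mul (x : A ⊗[k] A) (h : A) :
    (TensorProduct.assoc k A A A).symm (TensorProduct.map LinearMap.id W.comul x) * rr (W.comul h)
      = (TensorProduct.assoc k A A A).symm
          (TensorProduct.map LinearMap.id W.comul (x * (1 ⊗ₜ h))) := by
  have key : ∀ (a : A) (y z : A ⊗[k] A), (TensorProduct.assoc k A A A).symm (a ⊗ₜ y) * rr z
      = (TensorProduct.assoc k A A A).symm (a ⊗ₜ (y * z)) := by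
    intro a y z
    induction y with
    | zero => simp
    | add x y hx hy => simp only [map_add, TensorProduct.tmul_add, add_mul, hx, hy]
    | tmul b c =>
      induction z with
      | zero => simp
      | add x y hx hy => simp only [map_add, TensorProduct.tmul_add, mul_add, hx, hy]
      | tmul d e => simp [rr_tmul]
  induction x with
  | zero => simp
  | add x y hx hy => simp only [map_add, add_mul, hx, hy]
  | tmul a b => simp [W.comul_mul, key]

/-- `h₁ ⊗ ε_t(h₂) = 1₁ h ⊗ 1₂`. -/
lemma factF1 (h : A) : TensorProduct.map LinearMap.id W.εt (W.comul h)
    = W.comul 1 * (h ⊗ₜ 1) := by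
  have e : (W.comul h) ⊗ₜ[k] (1 : A) = (W.comul 1 ⊗ₜ 1) * (W.comul h ⊗ₜ 1) := by
    simp [comul_one_mul]
  rw [map_id_εt, e, ← mul_assoc, ← rr_apply, ← W.comul_one_right, comul_left_mul, kap2_comul_left]

lemma map_εs_one : TensorProduct.map W.εs LinearMap.id (W.comul 1) = W.comul 1 := by
  rw [map_εs_id, ← rr_apply, ← W.comul_one_right, kap2_comul_left]

lemma εt_sum {D : Finset (A × A)} (hD : W.comul 1 = ∑ p ∈ D, p.1 ⊗ₜ[k] p.2) (h : A) :
    W.εt h = ∑ p ∈ D, W.counit (p.1 * h) • p.2 := by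
  simp [εt_apply, hD, Finset.sum_mul]

lemma εs_sum {D : Finset (A × A)} (hD : W.comul 1 = ∑ p ∈ D, p.1 ⊗ₜ[k] p.2) (h : A) :
    W.εs h = ∑ p ∈ D, W.counit (h * p.2) • p.1 := by
  simp [εs_apply, hD, Finset.mul_sum]

lemma counit_sum_left {g : A} {G : Finset (A × A)} (hG : W.comul g = ∑ p ∈ G, p.1 ⊗ₜ[k] p.2)
    (f h : A) : W.counit (f * g * h) = ∑ p ∈ G, W.counit (f * p.1) * W.counit (p.2 * h) := by
  simp [W.counit_mul_left, hG]

lemma counit_sum_right {g : A} {G : Finset (A × A)} (hG : W.comul g = ∑ p ∈ G, p.1 ⊗ₜ[k] p.2)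
    (f h : A) : W.counit (f * g * h) = ∑ p ∈ G, W.counit (p.1 * h) * W.counit (f * p.2) := by
  simp [W.counit_mul_right, hG]

lemma εt_mul_sum {g : A} {G : Finset (A × A)} (hG : W.comul g = ∑ p ∈ G, p.1 ⊗ₜ[k] p.2)
    (h : A) : W.εt (g * h) = ∑ q ∈ G, W.counit (q.2 * h) • W.εt q.1 := by
  obtain ⟨D, hD⟩ := TensorProduct.exists_finset (W.comul 1)
  simp only [W.εt_sum hD, Finset.smul_sum]
  rw [Finset.sum_comm]
  refine Finset.sum_congr rfl fun p _ => ?_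
  rw [← mul_assoc, W.counit_sum_left hG, Finset.sum_smul]
  refine Finset.sum_congr rfl fun q _ => ?_
  rw [smul_smul, mul_comm]

lemma counit_mul_εt (f h : A) : W.counit (f * W.εt h) = W.counit (f * h) := by
  obtain ⟨D, hD⟩ := TensorProduct.exists_finset (W.comul 1)
  have := W.counit_sum_right hD f h
  rw [mul_one] at this
  rw [this, W.εt_sum hD, Finset.mul_sum, map_sum]
  simp

lemma counit_εs_mul (f h : A) : W.counit (W.εs f * h) = W.counit (f * h) := by
  obtain ⟨D, hD⟩ := TensorProduct.exists_finset (W.comul 1)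
  have := W.counit_sum_right hD f h
  rw [mul_one] at this
  rw [this, W.εs_sum hD, Finset.sum_mul, map_sum]
  simp [mul_comm]

lemma εt_mul_εt (g h : A) : W.εt (g * W.εt h) = W.εt (g * h) := by
  obtain ⟨D, hD⟩ := TensorProduct.exists_finset (W.comul 1)
  simp only [W.εt_sum hD (g * _), ← mul_assoc, counit_mul_εt]

lemma εs_εs_mul (g h : A) : W.εs (W.εs g * h) = W.εs (g * h) := by
  obtain ⟨D, hD⟩ := TensorProduct.exists_finset (W.comul 1)
  simp only [W.εs_sum hD (_ * h), mul_assoc, counit_εs_mul]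

lemma map_εt_mul (x y : A ⊗[k] A) : TensorProduct.map W.εt LinearMap.id (x * y)
    = TensorProduct.map W.εt LinearMap.id
        (W.kap2 (TensorProduct.map W.comul LinearMap.id x * rr y)) := by
  induction x with
  | zero => simp
  | add x y hx hy => simp only [map_add, add_mul, hx, hy]
  | tmul a b =>
    induction y with
    | zero => simp
    | add x y hx hy => simp only [map_add, mul_add, hx, hy]
    | tmul c d =>
      obtain ⟨G, hG⟩ := TensorProduct.exists_finset (W.comul a)
      simp [rr_tmul, hG, Finset.sum_mul, TensorProduct.sum_tmul, kap2_tmul, W.εt_mul_sum hG]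

lemma factF2a (h : A) : TensorProduct.map W.εt LinearMap.id (W.comul h)
    = TensorProduct.map W.εt LinearMap.id (W.comul 1) * (1 ⊗ₜ h) := by
  have key : ∀ x : A ⊗[k] A, TensorProduct.map W.εt LinearMap.id (x * (1 ⊗ₜ h))
    = TensorProduct.map W.εt LinearMap.id x * (1 ⊗ₜ h) := by
    intro x
    induction x with
    | zero => simp
    | add x y hx hy => simp only [map_add, add_mul, hx, hy]
    | tmul a b => simp
  rw [← W.comul_one_mul h, map_εt_mul, coassoc_apply', comul_right_mul, kap2_comul_right, key]

/-- `Δ(ε_s(g)) = (1 ⊗ ε_s(g)) Δ(1)` -/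
lemma comul_εs (g : A) : W.comul (W.εs g) = (1 ⊗ₜ W.εs g) * W.comul 1 := by
  obtain ⟨D, hD⟩ := TensorProduct.exists_finset (W.comul 1)
  have h := W.comul_one_right
  have h2 := congrArg ((TensorProduct.rid k (A ⊗[k] A)).toLinearMap ∘ₗ
    TensorProduct.map LinearMap.id (W.counit ∘ₗ LinearMap.mulLeft k g)) h
  nth_rewrite 1 [hD] at h2
  nth_rewrite 1 [hD] at h2
  rw [W.εs_sum hD]
  simpa [rr_tmul, rr_apply, Finset.sum_mul, TensorProduct.tmul_sum] using h2

lemma comul_εt (g : A) : W.comul (W.εt g) = W.comul 1 * (W.εt g ⊗ₜ 1) := by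
  obtain ⟨D, hD⟩ := TensorProduct.exists_finset (W.comul 1)
  have h := W.comul_one_right
  rw [coassoc_apply'] at h
  have h2 := congrArg ((TensorProduct.lid k (A ⊗[k] A)).toLinearMap ∘ₗ
    TensorProduct.map (W.counit ∘ₗ LinearMap.mulRight k g) LinearMap.id ∘ₗ
    (TensorProduct.assoc k A A A).toLinearMap) h
  have key : ∀ (a b : A) (x : A ⊗[k] A), TensorProduct.lid k (A ⊗[k] A)
    (TensorProduct.map (W.counit ∘ₗ LinearMap.mulRight k g) LinearMap.id
    ((TensorProduct.assoc k A A A) (rr x * ((a ⊗ₜ b) ⊗ₜ 1)))) =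
      x * ((W.counit (a * g) • b) ⊗ₜ 1) := by
    intro a b x
    induction x with
    | zero => simp
    | add x y hx hy => simp only [map_add, add_mul, hx, hy]
    | tmul c d => simp [rr_tmul, TensorProduct.smul_tmul']
  nth_rewrite 1 [hD] at h2
  nth_rewrite 2 [hD] at h2
  rw [W.εt_sum hD]
  simp only [map_sum, map_smul, rr_apply, TensorProduct.sum_tmul, Finset.mul_sum,
    LinearMap.comp_apply, LinearEquiv.coe_coe, key] at h2 ⊢
  rw [← h2]
  simp

lemma comul_εs_mul (g h : A) : W.comul (W.εs g * h) = (1 ⊗ₜ W.εs g) * W.comul h := by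
  rw [W.comul_mul, comul_εs, mul_assoc, comul_one_mul]

lemma comul_mul_εt (g h : A) : W.comul (g * W.εt h) = W.comul g * (W.εt h ⊗ₜ 1) := by
  rw [W.comul_mul, comul_εt, ← mul_assoc, comul_mul_one]

lemma εs_comm_εt (g h : A) : W.εs g * W.εt h = W.εt h * W.εs g := by
  obtain ⟨D, hD⟩ := TensorProduct.exists_finset (W.comul 1)
  have e := W.comul_one_left.symm.trans W.comul_one_right
  have h2 := congrArg ((TensorProduct.rid k A).toLinearMap ∘ₗ
    TensorProduct.map ((TensorProduct.lid k A).toLinearMap ∘ₗ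
      TensorProduct.map (W.counit ∘ₗ LinearMap.mulRight k h) LinearMap.id)
      (W.counit ∘ₗ LinearMap.mulLeft k g)) e
  rw [hD] at h2
  rw [W.εs_sum hD, W.εt_sum hD]
  simp only [TensorProduct.tmul_sum, TensorProduct.sum_tmul, map_sum, Finset.sum_mul_sum,
    TensorProduct.assoc_symm_tmul, Algebra.TensorProduct.tmul_mul_tmul, LinearMap.comp_apply,
    TensorProduct.map_tmul, LinearEquiv.coe_coe, TensorProduct.rid_tmul, TensorProduct.lid_tmul,
    LinearMap.mulLeft_apply, LinearMap.mulRight_apply, one_mul, mul_one, LinearMap.id_apply] at h2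
  simp only [Finset.sum_mul_sum, smul_mul_smul_comm]
  rw [Finset.sum_comm] at h2
  symm
  rw [Finset.sum_comm]
  simp only [smul_smul] at h2
  rw [Finset.sum_comm] at h2
  have h3 := h2
  rw [Finset.sum_comm]
  convert h3 using 2
  · refine Finset.sum_congr rfl fun j _ => ?_
    rw [mul_comm]

section Conv

variable {C : Type*} [AddCommGroup C] [Module k C]

/-- Convolution of linear maps. -/
def cv (d : C →ₗ[k] C ⊗[k] C) (f g : C →ₗ[k] A) : C →ₗ[k] A :=
  LinearMap.mul' k A ∘ₗ TensorProduct.map f g ∘ₗ d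

lemma cv_assoc (d : C →ₗ[k] C ⊗[k] C)
    (hd : TensorProduct.map d LinearMap.id ∘ₗ d = (TensorProduct.assoc k C C C).symm.toLinearMap ∘ₗ
      TensorProduct.map LinearMap.id d ∘ₗ d) (f g h : C →ₗ[k] A) :
    cv d (cv d f g) h = cv d f (cv d g h) := by
  have key : LinearMap.mul' k A ∘ₗ TensorProduct.map (LinearMap.mul' k A ∘ₗ TensorProduct.map f g) h
      ∘ₗ (TensorProduct.assoc k C C C).symm.toLinearMap =
      LinearMap.mul' k A ∘ₗ
        TensorProduct.map f (LinearMap.mul' k A ∘ₗ TensorProduct.map g h) := by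
    ext a b c
    simp [mul_assoc]
  have e1 : cv d (cv d f g) h = (LinearMap.mul' k A ∘ₗ
      TensorProduct.map (LinearMap.mul' k A ∘ₗ TensorProduct.map f g) h) ∘ₗ
      (TensorProduct.map d LinearMap.id ∘ₗ d) := by
    rw [LinearMap.comp_assoc, ← LinearMap.comp_assoc d, ← TensorProduct.map_comp]
    rfl
  have e2 : cv d f (cv d g h) = (LinearMap.mul' k A ∘ₗ
      TensorProduct.map f (LinearMap.mul' k A ∘ₗ TensorProduct.map g h)) ∘ₗ
      (TensorProduct.map LinearMap.id d ∘ₗ d) := by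
    rw [LinearMap.comp_assoc, ← LinearMap.comp_assoc d, ← TensorProduct.map_comp]
    rfl
  rw [e1, hd, e2, ← key]
  rfl

lemma cv_apply {d : C →ₗ[k] C ⊗[k] C} {c : C} {G : Finset (C × C)}
    (hG : d c = ∑ p ∈ G, p.1 ⊗ₜ[k] p.2) (f g : C →ₗ[k] A) :
    cv d f g c = ∑ p ∈ G, f p.1 * g p.2 := by
  simp [cv, hG]

end Conv

lemma cv_id_S : cv W.comul LinearMap.id W.antipode = W.εt :=
  LinearMap.ext W.antipode_left

lemma cv_S_id : cv W.comul W.antipode LinearMap.id = W.εs :=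
  LinearMap.ext W.antipode_right

lemma cv_εs_S : cv W.comul W.εs W.antipode = W.antipode := by
  rw [← cv_S_id]
  ext h
  refine Eq.trans ?_ (W.antipode_mid h)
  obtain ⟨G, hG⟩ := TensorProduct.exists_finset (W.comul h)
  rw [cv_apply hG, hG]
  simp [cv]

lemma cv_S_εt : cv W.comul W.antipode W.εt = W.antipode := by
  rw [← cv_id_S, ← cv_assoc _ W.comul_coassoc, cv_S_id, cv_εs_S]

/-- The Mathlib coalgebra structure. -/
@[reducible] def toCoalg : Coalgebra k A where
  comul := W.comul
  counit := W.counit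
  coassoc := by
    have := W.comul_coassoc
    rw [LinearMap.rTensor, LinearMap.lTensor, this]
    ext x
    simp
  rTensor_counit_comp_comul := by
    ext h
    apply (TensorProduct.lid k A).injective
    simpa [LinearMap.rTensor] using W.counit_comul_left h
  lTensor_counit_comp_comul := by
    ext h
    apply (TensorProduct.rid k A).injective
    simpa [LinearMap.lTensor] using W.counit_comul_right h

/-- The comultiplication on `A ⊗ A`. -/
def comul2 : (A ⊗[k] A) →ₗ[k] (A ⊗[k] A) ⊗[k] (A ⊗[k] A) :=
  (TensorProduct.tensorTensorTensorComm k A A A A).toLinearMap ∘ₗ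
    TensorProduct.map W.comul W.comul

lemma comul2_coassoc : TensorProduct.map W.comul2 LinearMap.id ∘ₗ W.comul2 =
    (TensorProduct.assoc k _ _ _).symm.toLinearMap ∘ₗ
      TensorProduct.map LinearMap.id W.comul2 ∘ₗ W.comul2 := by
  letI := W.toCoalg
  exact (Coalgebra.coassoc_symm (R := k) (A := A ⊗[k] A)).symm

lemma comul2_sum {g h : A} {G H : Finset (A × A)} (hG : W.comul g = ∑ p ∈ G, p.1 ⊗ₜ[k] p.2)
    (hH : W.comul h = ∑ p ∈ H, p.1 ⊗ₜ[k] p.2) : W.comul2 (g ⊗ₜ h) =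
    ∑ p ∈ G, ∑ q ∈ H, (p.1 ⊗ₜ[k] q.1) ⊗ₜ[k] (p.2 ⊗ₜ q.2) := by
  simp [comul2, hG, hH, TensorProduct.sum_tmul, TensorProduct.tmul_sum]
  exact Finset.sum_comm

lemma cv2_apply {g h : A} {G H : Finset (A × A)} (hG : W.comul g = ∑ p ∈ G, p.1 ⊗ₜ[k] p.2)
    (hH : W.comul h = ∑ p ∈ H, p.1 ⊗ₜ[k] p.2) (f f' : A ⊗[k] A →ₗ[k] A) :
    cv W.comul2 f f' (g ⊗ₜ h) = ∑ p ∈ G, ∑ q ∈ H, f (p.1 ⊗ₜ q.1) * f' (p.2 ⊗ₜ q.2) := by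
  simp [cv, W.comul2_sum hG hH]

/-- `g ⊗ h ↦ S(h) S(g)` -/
def revS : A ⊗[k] A →ₗ[k] A :=
  LinearMap.mul' k A ∘ₗ TensorProduct.map W.antipode W.antipode ∘ₗ
    (TensorProduct.comm k A A).toLinearMap

lemma revS_tmul (g h : A) : W.revS (g ⊗ₜ h) = W.antipode h * W.antipode g := rfl

lemma cv2_mul (f f' : A →ₗ[k] A) : cv W.comul2 (f ∘ₗ LinearMap.mul' k A)
    (f' ∘ₗ LinearMap.mul' k A) = cv W.comul f f' ∘ₗ LinearMap.mul' k A := by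
  ext g h
  obtain ⟨G, hG⟩ := TensorProduct.exists_finset (W.comul g)
  obtain ⟨H, hH⟩ := TensorProduct.exists_finset (W.comul h)
  change cv W.comul2 _ _ (g ⊗ₜ h) = LinearMap.mul' k A (TensorProduct.map f f' (W.comul (g * h)))
  rw [W.cv2_apply hG hH, W.comul_mul, hG, hH]
  simp [Finset.sum_mul_sum]

lemma cv2_revS_mul : cv W.comul2 W.revS (LinearMap.mul' k A) = W.εs ∘ₗ LinearMap.mul' k A := by
  ext g h
  obtain ⟨G, hG⟩ := TensorProduct.exists_finset (W.comul g)
  obtain ⟨H, hH⟩ := TensorProduct.exists_finset (W.comul h)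
  change cv W.comul2 _ _ (g ⊗ₜ h) = W.εs (g * h)
  rw [W.cv2_apply hG hH, ← W.εs_εs_mul, ← LinearMap.congr_fun W.cv_S_id (_ * _)]
  change _ = LinearMap.mul' k A (TensorProduct.map W.antipode LinearMap.id (W.comul _))
  rw [W.comul_εs_mul, hH, ← W.cv_S_id, cv_apply hG]
  simp only [revS_tmul, Finset.mul_sum, map_sum, Algebra.TensorProduct.tmul_mul_tmul,
    TensorProduct.map_tmul, LinearMap.mul'_apply, Finset.sum_mul]
  rw [Finset.sum_comm]
  simp [mul_assoc]

lemma cv2_mul_revS : cv W.comul2 (LinearMap.mul' k A) W.revS = W.εt ∘ₗ LinearMap.mul' k A := by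
  ext g h
  obtain ⟨G, hG⟩ := TensorProduct.exists_finset (W.comul g)
  obtain ⟨H, hH⟩ := TensorProduct.exists_finset (W.comul h)
  change cv W.comul2 _ _ (g ⊗ₜ h) = W.εt (g * h)
  rw [W.cv2_apply hG hH, ← W.εt_mul_εt, ← LinearMap.congr_fun W.cv_id_S (_ * _)]
  change _ = LinearMap.mul' k A (TensorProduct.map LinearMap.id W.antipode (W.comul _))
  rw [W.comul_mul_εt, hG, ← W.cv_id_S, cv_apply hH]
  simp [revS_tmul, Finset.mul_sum, Finset.sum_mul, mul_assoc]

/-- `S * (x ↦ x₁ z S(x₂)) = z S` for `z` in the target base. -/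
lemma S_conj (z g : A) :
    cv W.comul W.antipode (cv W.comul LinearMap.id
      (LinearMap.mulLeft k (W.εt z) ∘ₗ W.antipode)) g = W.εt z * W.antipode g := by
  rw [← cv_assoc _ W.comul_coassoc, cv_S_id]
  conv_rhs => rw [← W.cv_εs_S]
  obtain ⟨G, hG⟩ := TensorProduct.exists_finset (W.comul g)
  rw [cv_apply hG, cv_apply hG, Finset.mul_sum]
  refine Finset.sum_congr rfl fun p _ => ?_
  simp only [LinearMap.comp_apply, LinearMap.mulLeft_apply, ← mul_assoc, εs_comm_εt]

lemma cv2_revS_revS : cv W.comul2 W.revS (cv W.comul2 (LinearMap.mul' k A) W.revS) = W.revS := by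
  rw [cv2_mul_revS]
  ext g h
  obtain ⟨G, hG⟩ := TensorProduct.exists_finset (W.comul g)
  obtain ⟨H, hH⟩ := TensorProduct.exists_finset (W.comul h)
  change cv W.comul2 _ _ (g ⊗ₜ h) = W.antipode h * W.antipode g
  rw [W.cv2_apply hG hH, Finset.sum_comm]
  conv_rhs => rw [← W.cv_S_εt, cv_apply hH, Finset.sum_mul]
  refine Finset.sum_congr rfl fun q _ => ?_
  rw [mul_assoc, ← LinearMap.congr_fun rfl g, W.cv_S_εt, ← S_conj, cv_apply hG, Finset.mul_sum]
  refine Finset.sum_congr rfl fun p _ => ?_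
  rw [revS_tmul, mul_assoc]
  congr 2
  change W.εt (p.2 * q.2) = _
  rw [← W.εt_mul_εt, ← LinearMap.congr_fun W.cv_id_S (_ * _)]
  change LinearMap.mul' k A (TensorProduct.map LinearMap.id W.antipode (W.comul _)) = _
  rw [W.comul_mul_εt]
  obtain ⟨P, hP⟩ := TensorProduct.exists_finset (W.comul p.2)
  rw [cv_apply hP, hP]
  simp [Finset.sum_mul, mul_assoc]

lemma antipode_mul (g h : A) : W.antipode (g * h) = W.antipode h * W.antipode g := by
  have hm : LinearMap.id ∘ₗ LinearMap.mul' k A = LinearMap.mul' k A := rfl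
  have a1 := W.cv2_mul W.antipode LinearMap.id
  have a2 := W.cv2_mul LinearMap.id W.antipode
  have a3 := W.cv2_mul W.εs W.antipode
  rw [hm, cv_S_id] at a1
  rw [hm, cv_id_S] at a2
  rw [cv_εs_S] at a3
  have : W.antipode ∘ₗ LinearMap.mul' k A = W.revS := by
    rw [← W.cv2_revS_revS, W.cv2_mul_revS, ← a2, ← cv_assoc _ W.comul2_coassoc,
      W.cv2_revS_mul, a3]
  exact LinearMap.congr_fun this (g ⊗ₜ h)

lemma factF2b : TensorProduct.map W.εt LinearMap.id (W.comul 1)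
    = TensorProduct.map W.antipode LinearMap.id (W.comul 1) := by
  -- both sides are `1₁ S(1₂) ⊗ 1₃`
  have e1 : ∀ f : A →ₗ[k] A, TensorProduct.map (cv W.comul f W.antipode) LinearMap.id (W.comul 1)
      = TensorProduct.map (LinearMap.mul' k A ∘ₗ TensorProduct.map f W.antipode) LinearMap.id
        (TensorProduct.map W.comul LinearMap.id (W.comul 1)) := by
    intro f
    generalize W.comul 1 = x
    induction x with
    | zero => simp
    | add x y hx hy => simp only [map_add, hx, hy]
    | tmul a b => simp [cv]
  have e2 : ∀ (f : A →ₗ[k] A) (x y : A ⊗[k] A),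
      TensorProduct.map (LinearMap.mul' k A ∘ₗ TensorProduct.map f W.antipode) LinearMap.id
        (rr y * (x ⊗ₜ 1)) =
      TensorProduct.map (LinearMap.mul' k A ∘ₗ TensorProduct.map LinearMap.id W.antipode)
        LinearMap.id (rr y * (TensorProduct.map f LinearMap.id x ⊗ₜ 1)) := by
    intro f x y
    induction x with
    | zero => simp
    | add x y hx hy => simp only [map_add, TensorProduct.add_tmul, mul_add, hx, hy]
    | tmul a b =>
      induction y with
      | zero => simp
      | add x y hx hy => simp only [map_add, add_mul, hx, hy]
      | tmul c d => simp [rr_tmul]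
  have h1 := e1 W.εs
  rw [W.comul_one_right, rr_apply, e2, map_εs_one, cv_εs_S] at h1
  have h2 := e1 LinearMap.id
  rw [W.comul_one_right, rr_apply, cv_id_S] at h2
  rw [h1, h2]

/-- `h₁₁ ⊗ h₁₂ S(h₂) = 1₁ h ⊗ 1₂` -/
lemma galois_right {h : A} {G : Finset (A × A)} (hG : W.comul h = ∑ p ∈ G, p.1 ⊗ₜ[k] p.2) :
    ∑ p ∈ G, W.comul p.1 * (1 ⊗ₜ W.antipode p.2) = W.comul 1 * (h ⊗ₜ 1) := by
  let Φ : (A ⊗[k] A) ⊗[k] A →ₗ[k] A ⊗[k] A :=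
    LinearMap.mul' k (A ⊗[k] A) ∘ₗ
      TensorProduct.map LinearMap.id (TensorProduct.mk k A A 1 ∘ₗ W.antipode)
  have e := congrArg Φ (W.coassoc_apply' h)
  have key : ∀ (a : A) (y : A ⊗[k] A), Φ ((TensorProduct.assoc k A A A).symm (a ⊗ₜ y)) =
      a ⊗ₜ LinearMap.mul' k A (TensorProduct.map LinearMap.id W.antipode y) := by
    intro a y
    induction y with
    | zero => simp
    | add x y hx hy => simp only [map_add, TensorProduct.tmul_add, hx, hy]
    | tmul b c => simp [Φ]
  rw [← factF1]
  rw [hG] at e ⊢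
  simp only [map_sum, TensorProduct.map_tmul, key] at e ⊢
  refine Eq.trans ?_ (e.trans ?_)
  · simp [Φ]
  · refine Finset.sum_congr rfl fun p _ => ?_
    rw [W.antipode_left]; rfl

/-- `h₂₁ S⁻¹(h₁) ⊗ h₂₂ = 1₁ ⊗ 1₂ h` -/
lemma galois_left (T : A →ₗ[k] A) (hT : ∀ a, T (W.antipode a) = a)
    (hT' : ∀ a, W.antipode (T a) = a)
    {h : A} {G : Finset (A × A)} (hG : W.comul h = ∑ p ∈ G, p.1 ⊗ₜ[k] p.2) :
    ∑ p ∈ G, W.comul p.2 * (T p.1 ⊗ₜ 1) = W.comul 1 * (1 ⊗ₜ h) := by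
  have hTm : ∀ a b, b * T a = T (a * W.antipode b) := by
    intro a b
    apply W.antipode_bijective.1
    rw [W.antipode_mul, hT', hT']
  let Φ : (A ⊗[k] A) ⊗[k] A →ₗ[k] A ⊗[k] A :=
    TensorProduct.map (T ∘ₗ LinearMap.mul' k A ∘ₗ TensorProduct.map LinearMap.id W.antipode)
      LinearMap.id
  have e := congrArg Φ (W.coassoc_apply' h)
  have key : ∀ (a : A) (y : A ⊗[k] A), Φ ((TensorProduct.assoc k A A A).symm (a ⊗ₜ y)) =
      y * (T a ⊗ₜ 1) := by
    intro a y
    induction y with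
    | zero => simp
    | add x y hx hy => simp only [map_add, TensorProduct.tmul_add, add_mul, hx, hy]
    | tmul b c => simp [Φ, hTm]
  have e3 : Φ (TensorProduct.map W.comul LinearMap.id (W.comul h)) =
      TensorProduct.map T LinearMap.id (TensorProduct.map W.εt LinearMap.id (W.comul h)) := by
    rw [← cv_id_S]
    simp only [hG, map_sum, TensorProduct.map_tmul]
    rfl
  have e4 : ∀ x : A ⊗[k] A, TensorProduct.map T LinearMap.id
      (TensorProduct.map W.antipode LinearMap.id x * (1 ⊗ₜ h)) = x * (1 ⊗ₜ h) := by
    intro x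
    induction x with
    | zero => simp
    | add x y hx hy => simp only [map_add, add_mul, hx, hy]
    | tmul b c => simp [hT]
  rw [e3, factF2a, factF2b, e4, hG] at e
  rw [e]
  simp only [map_sum, TensorProduct.map_tmul, key]
  rfl

end Aux
end WeakHopf

/-- If `M` is a left module algebra over a finite-dimensional weak Hopf
algebra `A` (with action `act`, satisfying `h·(mn) = (h₍₁₎·m)(h₍₂₎·n)` and
`h·1 = ε_t(h)·1`) and `I ⊆ M` a two-sided ideal, then `A·I = span{h·x : h ∈ A, x ∈ I}`
is a two-sided ideal of `M` stable under the action of `A`. -/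
theorem stmt_16 {k A M : Type*} [Field k]
    [Ring A] [Algebra k A] [FiniteDimensional k A]
    [Ring M] [Algebra k M]
    (W : WeakHopf k A)
    (act : A →ₗ[k] M →ₗ[k] M)
    (hact_mul : ∀ g h : A, act (g * h) = act g ∘ₗ act h)
    (hact_one : act 1 = LinearMap.id)
    (hma : ∀ (h : A) (m x : M), act h (m * x)
        = TensorProduct.lift
            ((LinearMap.mul k M).compl₁₂ (act.flip m) (act.flip x)) (W.comul h))
    (hma_one : ∀ h : A, act h 1 = act (W.εt h) 1)
    (I : Submodule k M)
    (hIl : ∀ (m : M), ∀ x ∈ I, m * x ∈ I)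
    (hIr : ∀ (m : M), ∀ x ∈ I, x * m ∈ I) :
    (∀ a ∈ Submodule.span k {m : M | ∃ (h : A) (x : M), x ∈ I ∧ m = act h x},
        ∀ m : M,
          m * a ∈ Submodule.span k {m : M | ∃ (h : A) (x : M), x ∈ I ∧ m = act h x} ∧
          a * m ∈ Submodule.span k {m : M | ∃ (h : A) (x : M), x ∈ I ∧ m = act h x}) ∧
    (∀ (h : A), ∀ a ∈ Submodule.span k {m : M | ∃ (h : A) (x : M), x ∈ I ∧ m = act h x},
        act h a ∈ Submodule.span k {m : M | ∃ (h : A) (x : M), x ∈ I ∧ m = act h x}) := by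
  let Φ : M → M → A ⊗[k] A →ₗ[k] M := fun m x => TensorProduct.lift
            ((LinearMap.mul k M).compl₁₂ (act.flip m) (act.flip x))
  have hΦ : ∀ h m x, act h (m * x) = Φ m x (W.comul h) := hma
  have hΦr : ∀ m x b y, Φ m (act b x) y = Φ m x (y * (1 ⊗ₜ b)) := by
    intro m x b y
    induction y with
    | zero => simp
    | add x y hx hy => simp only [map_add, add_mul, hx, hy]
    | tmul c d => simp [Φ, hact_mul]
  have hΦl : ∀ m x b y, Φ (act b m) x y = Φ m x (y * (b ⊗ₜ 1)) := by
    intro m x b y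
    induction y with
    | zero => simp
    | add x y hx hy => simp only [map_add, add_mul, hx, hy]
    | tmul c d => simp [Φ, hact_mul]
  let e := LinearEquiv.ofBijective W.antipode W.antipode_bijective
  have hT : ∀ a, e.symm.toLinearMap (W.antipode a) = a := fun a => e.symm_apply_apply a
  have hT' : ∀ a, W.antipode (e.symm.toLinearMap a) = a := fun a => e.apply_symm_apply a
  refine ⟨?_, ?_⟩
  · intro a ha m
    induction ha using Submodule.span_induction with
    | zero => simp
    | add x y _ _ hx hy =>
      rw [mul_add, add_mul]
      exact ⟨Submodule.add_mem _ hx.1 hy.1, Submodule.add_mem _ hx.2 hy.2⟩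
    | smul c x _ hx =>
      rw [mul_smul_comm, smul_mul_assoc]
      exact ⟨Submodule.smul_mem _ _ hx.1, Submodule.smul_mem _ _ hx.2⟩
    | mem a ha =>
      obtain ⟨h, x, hx, rfl⟩ := ha
      obtain ⟨G, hG⟩ := TensorProduct.exists_finset (W.comul h)
      constructor
      · have : m * act h x = ∑ p ∈ G, act p.2 (act (e.symm.toLinearMap p.1) m * x) := by
          simp only [hΦ, hΦl]
          rw [← map_sum, W.galois_left _ hT hT' hG, ← hΦr, ← hΦ, hact_one, LinearMap.id_apply]
        rw [this]
        exact Submodule.sum_mem _ fun p _ =>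
          Submodule.subset_span ⟨p.2, _, hIl _ _ hx, rfl⟩
      · have : act h x * m = ∑ p ∈ G, act p.1 (x * act (W.antipode p.2) m) := by
          simp only [hΦ, hΦr]
          rw [← map_sum, W.galois_right hG, ← hΦl, ← hΦ, hact_one, LinearMap.id_apply]
        rw [this]
        exact Submodule.sum_mem _ fun p _ =>
          Submodule.subset_span ⟨p.1, _, hIr _ _ hx, rfl⟩
  · intro h a ha
    induction ha using Submodule.span_induction with
    | zero => simp
    | add x y _ _ hx hy => rw [map_add]; exact Submodule.add_mem _ hx hy
    | smul c x _ hx => rw [map_smul]; exact Submodule.smul_mem _ _ hx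
    | mem a ha =>
      obtain ⟨g, x, hx, rfl⟩ := ha
      exact Submodule.subset_span ⟨h * g, x, hx, by rw [hact_mul]; rfl⟩
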